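/- Let h be a threshold function that is (nonstrictly) increasing and satisfies h(ℓ) ≤ ℓ for all ℓ ≥ 1, and let χ be a child distribution supported within {0,1,…,n}, not equal to the point mass δ_1 at 1, such that (χ,h) is m-critical (m-concordant with maximum threshold m). Fix an integer r ≥ n+1 and suppose h(r) = m+1. Define φ: (0,1] → ℝ by φ(x) = (x − Σ_{ℓ=1}^{n} χ(ℓ)·B≥_{ℓ,h(ℓ)}(x)) / B≥_{r,m+1}(x). Then 0 < φ(x) ≤ χ(0) for all x ∈ (0,1], and φ is strictly increasing on (0,1]. -/

import Mathlib

/-- `B≥_{n,k}(x) = Σ_{j=k}^{n} C(n,j)·x^j·(1−x)^{n−j}`. -/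
noncomputable def Bge (n k : ℕ) (x : ℝ) : ℝ :=
  ∑ j ∈ Finset.Icc k n, (n.choose j : ℝ) * x ^ j * (1 - x) ^ (n - j)

/-- A child distribution: nonnegative, summable, total mass one. -/
def IsChildDist (χ : ℕ → ℝ) : Prop :=
  (∀ n, 0 ≤ χ n) ∧ Summable χ ∧ (∑' n, χ n) = 1

/-- The automaton distribution map of a recursive tree system `(χ, h)`. -/
noncomputable def Psi (χ : ℕ → ℝ) (h : ℕ → ℕ) (x : ℝ) : ℝ :=
  ∑' n, χ n * Bge n (h n) x

/-- `Ψ` is `m`-concordant: the first `m` derivatives of `Ψ` at `0` (within `[0,1]`)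
match those of the identity, i.e. `Ψ'(0) = 1` and `Ψ^{(k)}(0) = 0` for `2 ≤ k ≤ m`.
(For `m = 0` the condition is vacuous.) -/
def Concordant (m : ℕ) (Ψ : ℝ → ℝ) : Prop :=
  (1 ≤ m → iteratedDerivWithin 1 Ψ (Set.Icc (0 : ℝ) 1) 0 = 1) ∧
  ∀ k, 2 ≤ k → k ≤ m → iteratedDerivWithin k Ψ (Set.Icc (0 : ℝ) 1) 0 = 0

open Polynomial

theorem coeff_nonneg_of_initial_nonneg {R T : ℝ[X]} (hT : T = (1 - X) * R) (i : ℕ)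
    (hi : ∀ k ≤ i, 0 ≤ T.coeff k) : 0 ≤ R.coeff i := by
  subst hT
  induction i with
  | zero => simpa [sub_mul] using hi 0 le_rfl
  | succ i ih =>
    have h1 := ih fun k hk => hi k (by omega)
    have h2 := hi (i + 1) le_rfl
    simp only [sub_mul, one_mul, coeff_sub, coeff_X_mul] at h2
    linarith

theorem coeff_nonneg_of_final_nonpos {R T : ℝ[X]} (hT : T = (1 - X) * R) (i : ℕ)
    (hi : ∀ k, i < k → T.coeff k ≤ 0) : 0 ≤ R.coeff i := by
  subst hT
  have key : ∀ N, R.coeff (i + N) ≤ R.coeff i := by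
    intro N
    induction N with
    | zero => simp
    | succ N ih =>
      have h2 := hi (i + N + 1) (by omega)
      simp only [sub_mul, one_mul, coeff_sub, coeff_X_mul] at h2
      rw [← add_assoc]
      linarith
  have := key (R.natDegree + 1)
  rwa [coeff_eq_zero_of_natDegree_lt (by omega)] at this

theorem exists_coeff_ne_zero_of_coeff_ne_zero {R T : ℝ[X]} (hT : T = (1 - X) * R) {i : ℕ}
    (hi : R.coeff i ≠ 0) : ∃ k, i < k ∧ T.coeff k ≠ 0 := by
  by_contra! hk
  have h1 := coeff_nonneg_of_final_nonpos hT i fun k hik => (hk k hik).le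
  have h2 := coeff_nonneg_of_final_nonpos (R := -R) (T := -T) (by rw [hT]; ring) i
    fun k hik => by simp [hk k hik]
  rw [coeff_neg] at h2
  exact hi (by linarith)

theorem exists_quotient_coeff_nonneg {n m : ℕ} {a : ℕ → ℝ} {h : ℕ → ℕ}
    (ha : ∀ l, 0 ≤ a l) (hh : ∀ k, 1 ≤ h k) (hmono : Monotone h) (hle : ∀ k, 1 ≤ k → h k ≤ k)
    (hdvd : (1 - X : ℝ[X]) ^ m ∣
      1 - ∑ l ∈ Finset.Icc 1 n, C (a l) * (1 - X) ^ (h l - 1) * X ^ (l - h l))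
    (j : ℕ) (hj : j ≤ m) :
    ∃ R : ℝ[X], (∀ i, 0 ≤ R.coeff i) ∧
      (∀ i, R.coeff i ≠ 0 → ∀ l, 1 ≤ l → j + 1 ≤ h l → i + j + 1 ≤ l) ∧
      (1 - X) ^ j * R = 1 - ∑ l ∈ Finset.Icc 1 n with h l ≤ j,
        C (a l) * (1 - X) ^ (h l - 1) * X ^ (l - h l) := by
  induction j with
  | zero =>
    refine ⟨1, fun i => ?_, fun i hi l hl _ => ?_, ?_⟩
    · rw [coeff_one]; split_ifs <;> norm_num
    · rw [coeff_one] at hi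
      simp only [ne_eq, ite_eq_right_iff, one_ne_zero, imp_false, not_not] at hi
      omega
    · rw [Finset.filter_false_of_mem]
      · simp
      · intro l _; have := hh l; omega
  | succ j ih =>
    obtain ⟨R, hR0, hRdeg, hR⟩ := ih (by omega)
    set p : ℝ[X] := ∑ l ∈ Finset.Icc 1 n with h l = j + 1, C (a l) * X ^ (l - h l) with hp
    have hpcoeff : ∀ k, p.coeff k =
        ∑ l ∈ Finset.Icc 1 n with h l = j + 1, if k = l - h l then a l else 0 := by
      intro k
      simp [hp, coeff_X_pow]
    have hp0 : ∀ k, 0 ≤ p.coeff k := fun k => by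
      rw [hpcoeff]
      exact Finset.sum_nonneg fun l _ => by split_ifs <;> simp [ha]
    have hpne : ∀ k, p.coeff k ≠ 0 → ∃ l, 1 ≤ l ∧ h l = j + 1 ∧ l = k + j + 1 := by
      intro k hk
      rw [hpcoeff] at hk
      obtain ⟨l, hl, hne⟩ := Finset.exists_ne_zero_of_sum_ne_zero hk
      simp only [Finset.mem_filter, Finset.mem_Icc] at hl
      have := hle l hl.1.1
      refine ⟨l, hl.1.1, hl.2, ?_⟩
      by_contra hcon
      exact hne (if_neg (by omega))
    have hsplit : (1 - X) ^ j * (R - p) = 1 - ∑ l ∈ Finset.Icc 1 n with h l ≤ j + 1,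
        C (a l) * (1 - X) ^ (h l - 1) * X ^ (l - h l) := by
      have hpj : (1 - X) ^ j * p = ∑ l ∈ Finset.Icc 1 n with h l = j + 1,
          C (a l) * (1 - X) ^ (h l - 1) * X ^ (l - h l) := by
        rw [hp, Finset.mul_sum]
        refine Finset.sum_congr rfl fun l hl => ?_
        rw [(Finset.mem_filter.mp hl).2, Nat.add_sub_cancel]
        ring
      have hunion : (Finset.Icc 1 n).filter (fun l => h l ≤ j + 1) =
          (Finset.Icc 1 n).filter (fun l => h l ≤ j) ∪
            (Finset.Icc 1 n).filter (fun l => h l = j + 1) := by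
        ext l
        simp only [Finset.mem_filter, Finset.mem_union]
        grind
      rw [hunion, Finset.sum_union, mul_sub, hR, hpj, sub_sub]
      rw [Finset.disjoint_filter]
      intro l _ h1 h2
      omega
    have htail : (1 - X : ℝ[X]) ^ (j + 1) ∣ ∑ l ∈ Finset.Icc 1 n with ¬ h l ≤ j + 1,
        C (a l) * (1 - X) ^ (h l - 1) * X ^ (l - h l) := by
      refine Finset.dvd_sum fun l hl => ?_
      have := (Finset.mem_filter.mp hl).2
      exact ((pow_dvd_pow _ (by omega)).mul_left _).mul_right _
    have hdvd' : (1 - X : ℝ[X]) ^ (j + 1) ∣ (1 - X) ^ j * (R - p) := by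
      have h1 := (pow_dvd_pow (1 - X : ℝ[X]) hj).trans hdvd
      rw [← Finset.sum_filter_add_sum_filter_not _ (fun l => h l ≤ j + 1), ← sub_sub,
        ← hsplit] at h1
      exact (dvd_sub_left htail).mp h1
    have hX : (1 - X : ℝ[X]) ≠ 0 := fun h0 => by
      simpa using congrArg (eval 0) h0
    rw [pow_succ] at hdvd'
    obtain ⟨R', hR'⟩ := (mul_dvd_mul_iff_left (pow_ne_zero j hX)).mp hdvd'
    refine ⟨R', fun i => ?_, fun i hi l hl hlj => ?_, ?_⟩
    · by_cases hex : ∃ k ≤ i, p.coeff k ≠ 0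
      · obtain ⟨k, hki, hk⟩ := hex
        obtain ⟨l, hl1, hl2, hl3⟩ := hpne k hk
        refine coeff_nonneg_of_final_nonpos hR' i fun k' hk' => ?_
        have : R.coeff k' = 0 := by
          by_contra hne
          have := hRdeg k' hne l hl1 hl2.ge
          omega
        rw [coeff_sub, this]
        linarith [hp0 k']
      · push Not at hex
        refine coeff_nonneg_of_initial_nonneg hR' i fun k hk => ?_
        rw [coeff_sub, hex k hk, sub_zero]
        exact hR0 k
    · obtain ⟨k, hik, hk⟩ := exists_coeff_ne_zero_of_coeff_ne_zero hR' hi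
      by_cases hpk : p.coeff k = 0
      · rw [coeff_sub, hpk, sub_zero] at hk
        have := hRdeg k hk l hl (by omega)
        omega
      · obtain ⟨l', hl1, hl2, hl3⟩ := hpne k hpk
        have : l' < l := by
          by_contra hcon
          have := hmono (not_lt.mp hcon)
          omega
        omega
    · rw [pow_succ, mul_assoc, ← hR', hsplit]

theorem eval_mul_pow_lt {R : ℝ[X]} (h0 : ∀ i, 0 ≤ R.coeff i) (hR : R ≠ 0) {e : ℕ}
    (he : R.natDegree < e) {u v : ℝ} (hu : 0 < u) (huv : u < v) :
    R.eval v * u ^ e < R.eval u * v ^ e := by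
  have hv := hu.trans huv
  have key : ∀ i < e, v ^ i * u ^ e < u ^ i * v ^ e := by
    intro i hi
    obtain ⟨d, rfl⟩ := Nat.exists_eq_add_of_lt hi
    have : u ^ (d + 1) < v ^ (d + 1) := pow_lt_pow_left₀ huv hu.le (by omega)
    have h2 : 0 < v ^ i * u ^ i := by positivity
    calc v ^ i * u ^ (i + d + 1) = v ^ i * u ^ i * u ^ (d + 1) := by ring
      _ < v ^ i * u ^ i * v ^ (d + 1) := by gcongr
      _ = _ := by ring
  rw [eval_eq_sum_range, eval_eq_sum_range, Finset.sum_mul, Finset.sum_mul]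
  refine Finset.sum_lt_sum (fun i hi => ?_) ⟨R.natDegree, by simp, ?_⟩
  · rw [mul_assoc, mul_assoc]
    exact mul_le_mul_of_nonneg_left (key i (by simp at hi; omega)).le (h0 i)
  · rw [mul_assoc, mul_assoc]
    refine mul_lt_mul_of_pos_left (key _ he) ((h0 _).lt_of_ne' ?_)
    exact leadingCoeff_ne_zero.mpr hR

theorem natDegree_C_mul_one_sub_X_pow_mul_X_pow_le (a : ℝ) (i j : ℕ) :
    (C a * (1 - X : ℝ[X]) ^ i * X ^ j).natDegree ≤ i + j := by
  compute_degree

theorem eq_zero_of_sum_eq_one {n : ℕ} {a : ℕ → ℝ} {h : ℕ → ℕ}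
    (hh : ∀ k, 1 ≤ h k) (hle : ∀ k, 1 ≤ k → h k ≤ k)
    (hsum : ∑ l ∈ Finset.Icc 1 n, C (a l) * (1 - X : ℝ[X]) ^ (h l - 1) * X ^ (l - h l) = 1)
    {l : ℕ} (hl : l ∈ Finset.Icc 2 n) : a l = 0 := by
  by_contra hne
  have hS : ((Finset.Icc 2 n).filter fun l => a l ≠ 0).Nonempty :=
    ⟨l, Finset.mem_filter.mpr ⟨hl, hne⟩⟩
  obtain ⟨L, hL, hmax⟩ := Finset.exists_max_image _ id hS
  simp only [Finset.mem_filter, Finset.mem_Icc, id] at hL hmax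
  have hdeg : (1 - X : ℝ[X]).natDegree ≤ 1 := by compute_degree
  have hcoeff := congrArg (fun p => coeff p (L - 1)) hsum
  have hhL := hh L
  have hleL := hle L (by omega)
  simp only [finsetSum_coeff] at hcoeff
  rw [Finset.sum_eq_single L, coeff_one, if_neg (by omega)] at hcoeff
  · rw [show L - 1 = (h L - 1) * 1 + (L - h L) by omega, coeff_mul_X_pow, coeff_C_mul,
      coeff_pow_of_natDegree_le hdeg] at hcoeff
    have : (1 - X : ℝ[X]).coeff 1 = -1 := by simp [coeff_one]
    rw [this] at hcoeff
    simp [hL.2] at hcoeff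
  · intro l hl hlL
    rw [Finset.mem_Icc] at hl
    rcases lt_or_gt_of_ne hlL with hlt | hgt
    · apply coeff_eq_zero_of_natDegree_lt
      have h1 := hh l
      have h2 := hle l hl.1
      have h3 := natDegree_C_mul_one_sub_X_pow_mul_X_pow_le (a l) (h l - 1) (l - h l)
      omega
    · have : a l = 0 := by
        by_contra hal
        have := hmax l ⟨by omega, hal⟩
        omega
      simp [this]
  · intro hL'
    exact absurd (Finset.mem_Icc.mpr ⟨by omega, hL.1.2⟩) hL'

/-- The polynomial whose evaluation is `Bge n k`. -/
noncomputable def bernsteinTail (n k : ℕ) : ℝ[X] :=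
  ∑ j ∈ Finset.Icc k n, bernsteinPolynomial ℝ n j

theorem eval_bernsteinTail (n k : ℕ) (x : ℝ) : (bernsteinTail n k).eval x = Bge n k x := by
  simp [bernsteinTail, Bge, bernsteinPolynomial, eval_finsetSum]

theorem Bge_zero_right {n k : ℕ} (hk : 1 ≤ k) : Bge n k 0 = 0 := by
  refine Finset.sum_eq_zero fun j hj => ?_
  have := (Finset.mem_Icc.mp hj).1
  rw [zero_pow (by omega)]
  ring

theorem Bge_one_right {n k : ℕ} (hk : k ≤ n) : Bge n k 1 = 1 := by
  rw [Bge, Finset.sum_eq_single n]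
  · simp
  · intro j hj hjn
    have := (Finset.mem_Icc.mp hj).2
    rw [sub_self, zero_pow (by omega), mul_zero]
  · intro hn
    exact absurd (Finset.mem_Icc.mpr ⟨hk, le_rfl⟩) hn

theorem derivative_bernsteinTail (n k : ℕ) (hk : 1 ≤ k) :
    derivative (bernsteinTail n k) =
      C ((n : ℝ) * ((n - 1).choose (k - 1) : ℕ)) * X ^ (k - 1) * (1 - X) ^ (n - k) := by
  obtain ⟨k, rfl⟩ := Nat.exists_eq_add_of_le' hk
  rcases lt_or_ge n (k + 1) with hn | hn
  · rw [bernsteinTail, Finset.Icc_eq_empty (by omega)]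
    rcases Nat.eq_zero_or_pos n with rfl | hpos
    · simp
    · simp [Nat.choose_eq_zero_of_lt (show n - 1 < k by omega)]
  · have tele : ∀ N, k ≤ N → derivative (∑ j ∈ Finset.Ico (k + 1) (N + 1),
        bernsteinPolynomial ℝ n j) =
        n * (bernsteinPolynomial ℝ (n - 1) k - bernsteinPolynomial ℝ (n - 1) N) := by
      intro N hN
      induction N, hN using Nat.le_induction with
      | base => simp
      | succ N hN ih =>
        rw [Finset.sum_Ico_succ_top (by omega), derivative_add, ih,
          bernsteinPolynomial.derivative_succ]
        ring
    have := tele n (by omega)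
    rw [bernsteinPolynomial.eq_zero_of_lt ℝ (show n - 1 < n by omega), sub_zero] at this
    rw [bernsteinTail]
    change derivative (∑ j ∈ Finset.Ico (k + 1) (n + 1), bernsteinPolynomial ℝ n j) = _
    rw [this, bernsteinPolynomial, Nat.add_sub_cancel, show n - 1 - k = n - (k + 1) by omega]
    simp only [map_mul, map_natCast]
    ring

theorem iteratedDerivWithin_eval (p : ℝ[X]) (k : ℕ) :
    iteratedDerivWithin k (fun x => p.eval x) (Set.Icc 0 1) 0 = k.factorial * p.coeff k := by
  have hder : ∀ k, iteratedDeriv k (fun x => p.eval x) =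
      fun x => (derivative^[k] p).eval x := by
    intro k
    induction k with
    | zero => simp
    | succ k ih =>
      rw [iteratedDeriv_succ, ih, Function.iterate_succ_apply']
      ext x
      exact Polynomial.deriv _
  have hcd : ContDiff ℝ k fun x => p.eval x := by
    simpa only [coe_aeval_eq_eval] using contDiff_aeval (𝕜 := ℝ) p k
  rw [iteratedDerivWithin_eq_iteratedDeriv uniqueDiffOn_Icc_zero_one hcd.contDiffAt (by simp),
    hder]
  beta_reduce
  rw [← coeff_zero_eq_eval_zero, coeff_iterate_derivative]
  simp [Nat.descFactorial_self]

theorem strictMonoOn_eval_of_derivative_pos {p : ℝ[X]}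
    (hp : ∀ x ∈ Set.Ioo (0 : ℝ) 1, 0 < (derivative p).eval x) :
    StrictMonoOn (fun x => p.eval x) (Set.Icc 0 1) := by
  refine strictMonoOn_of_deriv_pos (convex_Icc 0 1) p.continuousOn fun x hx => ?_
  rw [interior_Icc] at hx
  rw [Polynomial.deriv]
  exact hp x hx

theorem eval_pos_of_derivative_pos {p : ℝ[X]} (hp0 : p.eval 0 = 0)
    (hp : ∀ x ∈ Set.Ioo (0 : ℝ) 1, 0 < (derivative p).eval x) {x : ℝ}
    (hx : x ∈ Set.Ioc (0 : ℝ) 1) : 0 < p.eval x := by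
  simpa [hp0] using strictMonoOn_eval_of_derivative_pos hp ⟨le_rfl, zero_le_one⟩
    ⟨hx.1.le, hx.2⟩ hx.1

/-- If the ratio of derivatives is strictly increasing, so is the ratio of the polynomials. -/
theorem strictMonoOn_eval_div_eval {F G : ℝ[X]} (hF : F.eval 0 = 0) (hG : G.eval 0 = 0)
    (hG' : ∀ x ∈ Set.Ioo (0 : ℝ) 1, 0 < (derivative G).eval x)
    (hFG : ∀ x ∈ Set.Ioo (0 : ℝ) 1, ∀ y ∈ Set.Ioo (0 : ℝ) 1, x < y →
      (derivative F).eval x * (derivative G).eval y <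
        (derivative F).eval y * (derivative G).eval x) :
    StrictMonoOn (fun x => F.eval x / G.eval x) (Set.Ioc 0 1) := by
  have hmono := strictMonoOn_eval_of_derivative_pos hG'
  intro x hx y hy hxy
  have cauchy : ∀ a b : ℝ, a < b → ∃ c ∈ Set.Ioo a b,
      (G.eval b - G.eval a) * (derivative F).eval c =
        (F.eval b - F.eval a) * (derivative G).eval c := fun a b hab =>
    exists_ratio_hasDerivAt_eq_ratio_slope (fun x => F.eval x) (fun x => (derivative F).eval x) hab
      F.continuousOn (fun x _ => F.hasDerivAt x) (fun x => G.eval x)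
      (fun x => (derivative G).eval x) G.continuousOn (fun x _ => G.hasDerivAt x)
  obtain ⟨c, hc, hc'⟩ := cauchy 0 x hx.1
  obtain ⟨d, hd, hd'⟩ := cauchy x y hxy
  rw [hF, hG, sub_zero, sub_zero] at hc'
  have hc1 : c ∈ Set.Ioo (0 : ℝ) 1 := ⟨hc.1, hc.2.trans_le hx.2⟩
  have hd1 : d ∈ Set.Ioo (0 : ℝ) 1 := ⟨hx.1.trans hd.1, hd.2.trans_le hy.2⟩
  have hGx : 0 < G.eval x := eval_pos_of_derivative_pos hG hG' hx
  have hGxy : G.eval x < G.eval y := hmono ⟨hx.1.le, hx.2⟩ ⟨hy.1.le, hy.2⟩ hxy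
  have hlt := hFG c hc1 d hd1 (hc.2.trans hd.1)
  have hgc := hG' c hc1
  have hgd := hG' d hd1
  have hFx : F.eval x = G.eval x * ((derivative F).eval c / (derivative G).eval c) := by
    field_simp; linarith
  have hFy : F.eval y =
      F.eval x + (G.eval y - G.eval x) * ((derivative F).eval d / (derivative G).eval d) := by
    field_simp; linarith
  have hratio : (derivative F).eval c / (derivative G).eval c <
      (derivative F).eval d / (derivative G).eval d := by
    rwa [div_lt_div_iff₀ hgc hgd]
  change F.eval x / G.eval x < F.eval y / G.eval y
  rw [div_lt_div_iff₀ hGx (hGx.trans hGxy)]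
  have := mul_pos (mul_pos hGx (sub_pos.mpr hGxy)) (sub_pos.mpr hratio)
  rw [hFy, hFx]
  linarith

theorem psi_eq_sum {n : ℕ} {h : ℕ → ℕ} (hh : ∀ k, 1 ≤ h k) {χ : ℕ → ℝ}
    (hsupp : ∀ k, n < k → χ k = 0) (x : ℝ) :
    Psi χ h x = ∑ k ∈ Finset.Icc 1 n, χ k * Bge k (h k) x := by
  refine tsum_eq_sum fun k hk => ?_
  rcases Nat.eq_zero_or_pos k with rfl | hpos
  · rw [Bge, Finset.Icc_eq_empty (by have := hh 0; omega)]
    simp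
  · rw [hsupp k (by rw [Finset.mem_Icc] at hk; omega), zero_mul]

theorem IsChildDist.add_sum_Icc_eq_one {n : ℕ} {χ : ℕ → ℝ} (hχ : IsChildDist χ)
    (hsupp : ∀ k, n < k → χ k = 0) : χ 0 + ∑ k ∈ Finset.Icc 1 n, χ k = 1 := by
  rw [← hχ.2.2, tsum_eq_sum (s := Finset.Icc 0 n) fun k hk => hsupp k (by simpa using hk),
    ← Finset.add_sum_Ioc_eq_sum_Icc (Nat.zero_le n)]
  rfl

theorem exists_derivative_factorization {m n : ℕ} (hm : 1 ≤ m) {h : ℕ → ℕ} (hh : ∀ k, 1 ≤ h k)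
    (hmono : Monotone h) (hle : ∀ k, 1 ≤ k → h k ≤ k) {χ : ℕ → ℝ} (hχ : IsChildDist χ)
    (hsupp : ∀ k, n < k → χ k = 0) (hne : χ ≠ fun k => if k = 1 then 1 else 0)
    (hconc : Concordant m (Psi χ h)) (hmaxle : ∀ k, 0 < χ k → h k ≤ m) {F : ℝ[X]}
    (hF : F = X - ∑ k ∈ Finset.Icc 1 n, C (χ k) * bernsteinTail k (h k)) :
    ∃ R : ℝ[X], R ≠ 0 ∧ (∀ i, 0 ≤ R.coeff i) ∧ m + R.natDegree < n ∧
      ∀ x, (derivative F).eval x = x ^ m * R.eval (1 - x) := by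
  set a : ℕ → ℝ := fun l => χ l * (l * ((l - 1).choose (h l - 1) : ℕ)) with ha
  have ha0 : ∀ l, 0 ≤ a l := fun l => mul_nonneg (hχ.1 l) (by positivity)
  have hF' : derivative F =
      1 - ∑ l ∈ Finset.Icc 1 n, C (a l) * X ^ (h l - 1) * (1 - X) ^ (l - h l) := by
    rw [hF, derivative_sub, derivative_X, derivative_sum]
    congr 1
    refine Finset.sum_congr rfl fun l _ => ?_
    rw [derivative_C_mul, derivative_bernsteinTail _ _ (hh l), ← mul_assoc, ← mul_assoc, ← C_mul]
  have hcomp : (derivative F).comp (1 - X) =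
      1 - ∑ l ∈ Finset.Icc 1 n, C (a l) * (1 - X) ^ (h l - 1) * X ^ (l - h l) := by
    simp [hF']
  have hpsi : Psi χ h = fun x => (X - F).eval x := by
    ext x
    simp [psi_eq_sum hh hsupp, hF, eval_finsetSum, eval_bernsteinTail]
  have hdvd : X ^ m ∣ derivative F := by
    rw [X_pow_dvd_iff]
    intro d hd
    rw [coeff_derivative]
    have hcoeff : F.coeff (d + 1) = 0 := by
      rw [hpsi] at hconc
      rcases Nat.eq_zero_or_pos d with rfl | hpos
      · have := hconc.1 hm
        rw [iteratedDerivWithin_eval] at this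
        simpa using this
      · have := hconc.2 (d + 1) (by omega) (by omega)
        rw [iteratedDerivWithin_eval] at this
        simpa [Nat.factorial_ne_zero, coeff_X, hpos.ne'] using this
    rw [hcoeff, zero_mul]
  have hdvd' : (1 - X : ℝ[X]) ^ m ∣
      1 - ∑ l ∈ Finset.Icc 1 n, C (a l) * (1 - X) ^ (h l - 1) * X ^ (l - h l) := by
    obtain ⟨Q, hQ⟩ := hdvd
    rw [← hcomp, hQ, mul_comp, X_pow_comp]
    exact dvd_mul_right _ _
  obtain ⟨R, hR0, -, hR⟩ := exists_quotient_coeff_nonneg ha0 hh hmono hle hdvd' m le_rfl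
  have hall : ∑ l ∈ Finset.Icc 1 n with h l ≤ m,
        C (a l) * (1 - X : ℝ[X]) ^ (h l - 1) * X ^ (l - h l) =
      ∑ l ∈ Finset.Icc 1 n, C (a l) * (1 - X) ^ (h l - 1) * X ^ (l - h l) := by
    refine Finset.sum_filter_of_ne fun l _ hl => hmaxle l ((hχ.1 l).lt_of_ne' fun h0 => hl ?_)
    simp [ha, h0]
  rw [hall] at hR
  have hn : 1 ≤ n := by
    by_contra hn
    rw [Finset.Icc_eq_empty hn] at hR
    have := congrArg (eval 1) hR
    simp [show m ≠ 0 by omega] at this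
  have hRne : R ≠ 0 := by
    rintro rfl
    rw [mul_zero, eq_comm, sub_eq_zero] at hR
    have hge : ∀ l, 2 ≤ l → χ l = 0 := by
      intro l hl
      rcases lt_or_ge n l with hnl | hnl
      · exact hsupp l hnl
      · have h0 := eq_zero_of_sum_eq_one hh hle hR.symm (Finset.mem_Icc.mpr ⟨hl, hnl⟩)
        have hpos : 0 < (l - 1).choose (h l - 1) :=
          Nat.choose_pos (by have := hle l (by omega); omega)
        simpa [ha, hpos.ne', show l ≠ 0 by omega] using h0
    have h1 : h 1 = 1 := le_antisymm (hle 1 le_rfl) (hh 1)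
    have hsingle : ∀ l ∈ Finset.Icc 1 n, l ≠ 1 → χ l = 0 := fun l hl hl1 =>
      hge l (by rw [Finset.mem_Icc] at hl; omega)
    have hmem : 1 ∈ Finset.Icc 1 n := Finset.mem_Icc.mpr ⟨le_rfl, hn⟩
    have hχ1 : χ 1 = 1 := by
      rw [Finset.sum_eq_single_of_mem 1 hmem
        (fun l hl hl1 => by simp [ha, hsingle l hl hl1])] at hR
      have := congrArg (eval 0) hR
      simpa [ha, h1, eq_comm] using this
    have hχ0 : χ 0 = 0 := by
      have := hχ.add_sum_Icc_eq_one hsupp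
      rw [Finset.sum_eq_single_of_mem 1 hmem hsingle, hχ1] at this
      linarith
    refine hne (funext fun k => ?_)
    rcases k with _ | _ | k
    · simpa using hχ0
    · simpa using hχ1
    · simpa using hge (k + 2) (by omega)
  refine ⟨R, hRne, hR0, ?_, fun x => ?_⟩
  · have hX1 : (1 - X : ℝ[X]).natDegree = 1 := by compute_degree!
    have hX : (1 - X : ℝ[X]) ^ m ≠ 0 := pow_ne_zero _ fun h0 => by
      rw [h0, natDegree_zero] at hX1
      omega
    have hdeg : ((1 - X) ^ m * R).natDegree ≤ n - 1 := by
      rw [hR]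
      refine (natDegree_sub_le _ _).trans (max_le (by simp) ?_)
      refine natDegree_sum_le_of_forall_le _ _ fun l hl => ?_
      rw [Finset.mem_Icc] at hl
      have h1 := hh l
      have h2 := hle l hl.1
      have h3 := natDegree_C_mul_one_sub_X_pow_mul_X_pow_le (a l) (h l - 1) (l - h l)
      omega
    rw [natDegree_mul hX hRne, natDegree_pow, hX1] at hdeg
    omega
  · have := congrArg (eval (1 - x)) (hcomp.trans hR.symm)
    simpa [eval_comp] using this

theorem stmt16 (m n r : ℕ) (hm : 1 ≤ m) (h : ℕ → ℕ) (hh : ∀ k, 1 ≤ h k)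
    (hmono : Monotone h) (hle : ∀ k, 1 ≤ k → h k ≤ k)
    (χ : ℕ → ℝ) (hχ : IsChildDist χ)
    (hsupp : ∀ k, n < k → χ k = 0)
    (hne : χ ≠ fun k => if k = 1 then 1 else 0)
    (hconc : Concordant m (Psi χ h))
    (hmaxle : ∀ k, 0 < χ k → h k ≤ m)
    (hmaxeq : ∃ k, 0 < χ k ∧ h k = m)
    (hr : n + 1 ≤ r) (hhr : h r = m + 1) :
    (∀ x ∈ Set.Ioc (0 : ℝ) 1,
      0 < (x - ∑ k ∈ Finset.Icc 1 n, χ k * Bge k (h k) x) / Bge r (m + 1) x ∧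
      (x - ∑ k ∈ Finset.Icc 1 n, χ k * Bge k (h k) x) / Bge r (m + 1) x ≤ χ 0) ∧
    StrictMonoOn
      (fun x => (x - ∑ k ∈ Finset.Icc 1 n, χ k * Bge k (h k) x) / Bge r (m + 1) x)
      (Set.Ioc (0 : ℝ) 1) := by
  obtain ⟨F, hF⟩ : ∃ F : ℝ[X],
    F = X - ∑ k ∈ Finset.Icc 1 n, C (χ k) * bernsteinTail k (h k) := ⟨_, rfl⟩
  obtain ⟨R, hRne, hR0, hdeg, hF'⟩ :=
    exists_derivative_factorization hm hh hmono hle hχ hsupp hne hconc hmaxle hF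
  have hFeval : ∀ x, F.eval x = x - ∑ k ∈ Finset.Icc 1 n, χ k * Bge k (h k) x := fun x => by
    simp [hF, eval_finsetSum, eval_bernsteinTail]
  have hF0 : F.eval 0 = 0 := by
    rw [hFeval, Finset.sum_eq_zero fun k _ => by rw [Bge_zero_right (hh k), mul_zero], sub_zero]
  have hF1 : F.eval 1 = χ 0 := by
    rw [hFeval, Finset.sum_congr rfl fun k hk => by
      rw [Bge_one_right (hle k (Finset.mem_Icc.mp hk).1), mul_one],
      ← hχ.add_sum_Icc_eq_one hsupp, add_sub_cancel_right]
  have hmr : m + 1 ≤ r := hhr ▸ hle r (by omega)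
  obtain ⟨c, hc, hG'⟩ : ∃ c : ℝ, 0 < c ∧ ∀ x, (derivative (bernsteinTail r (m + 1))).eval x =
      c * x ^ m * (1 - x) ^ (r - (m + 1)) := by
    refine ⟨r * ((r - 1).choose m : ℕ), ?_, fun x => ?_⟩
    · have : 0 < (r - 1).choose m := Nat.choose_pos (by omega)
      have : 0 < r := by omega
      positivity
    · simp [derivative_bernsteinTail]
  have hG0 : (bernsteinTail r (m + 1)).eval 0 = 0 := by
    rw [eval_bernsteinTail, Bge_zero_right (by omega)]
  have hG'pos : ∀ x ∈ Set.Ioo (0 : ℝ) 1, 0 < (derivative (bernsteinTail r (m + 1))).eval x := by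
    intro x hx
    rw [hG']
    have := hx.1
    have := sub_pos.mpr hx.2
    positivity
  have hstrict := strictMonoOn_eval_div_eval hF0 hG0 hG'pos fun x hx y hy hxy => by
    rw [hF', hF', hG', hG']
    have h1 := eval_mul_pow_lt hR0 hRne (e := r - (m + 1)) (by omega)
      (sub_pos.mpr hy.2) (sub_lt_sub_left hxy 1)
    have h2 : 0 < c * x ^ m * y ^ m := by
      have := hx.1
      have := hy.1
      positivity
    linear_combination mul_lt_mul_of_pos_left h1 h2
  have hF'pos : ∀ x ∈ Set.Ioo (0 : ℝ) 1, 0 < (derivative F).eval x := by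
    intro x hx
    rw [hF']
    have hx1 := sub_pos.mpr hx.2
    refine mul_pos (pow_pos hx.1 _) ?_
    rw [eval_eq_sum_range]
    refine Finset.sum_pos' (fun i _ => mul_nonneg (hR0 i) (by positivity))
      ⟨R.natDegree, by simp, ?_⟩
    exact mul_pos ((hR0 _).lt_of_ne' (leadingCoeff_ne_zero.mpr hRne)) (by positivity)
  simp only [← hFeval]
  simp only [← eval_bernsteinTail]
  refine ⟨fun x hx => ⟨div_pos (eval_pos_of_derivative_pos hF0 hF'pos hx)
    (eval_pos_of_derivative_pos hG0 hG'pos hx), ?_⟩, hstrict⟩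
  have := hstrict.monotoneOn hx ⟨zero_lt_one, le_rfl⟩ hx.2
  simpa [hF1, eval_bernsteinTail, Bge_one_right hmr] using this
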